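/- Let w₁₁, w₁₂, w₂₁, w₂₂, w₃₃ be real numbers and define the 4×4 complex matrix ρ := (1/4)(I₄ + w₁₁ σ₁⊗σ₁ + w₁₂ σ₁⊗σ₂ + w₂₁ σ₂⊗σ₁ + w₂₂ σ₂⊗σ₂ + w₃₃ σ₃⊗σ₃). Then ρ is positive semidefinite if and only if 1 + w₃₃ ≥ √((w₁₁ − w₂₂)² + (w₁₂ + w₂₁)²) and 1 − w₃₃ ≥ √((w₁₁ + w₂₂)² + (w₁₂ − w₂₁)²). -/

import Mathlib

open Matrix Kronecker Real ComplexOrder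

noncomputable section

def σ1 : Matrix (Fin 2) (Fin 2) ℂ := !![0, 1; 1, 0]
def σ2 : Matrix (Fin 2) (Fin 2) ℂ := !![0, -Complex.I; Complex.I, 0]
def σ3 : Matrix (Fin 2) (Fin 2) ℂ := !![1, 0; 0, -1]

/-- For `a ∈ ℝ³`, `a·σ := a₁σ₁ + a₂σ₂ + a₃σ₃`. -/
def dotSigma (a : Fin 3 → ℝ) : Matrix (Fin 2) (Fin 2) ℂ :=
  (a 0 : ℂ) • σ1 + (a 1 : ℂ) • σ2 + (a 2 : ℂ) • σ3

/-- Euclidean dot product on `ℝ³`. -/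
def dot3 (a b : Fin 3 → ℝ) : ℝ := a 0 * b 0 + a 1 * b 1 + a 2 * b 2

/-- A density matrix on `ℂ² ⊗ ℂ²`: positive semidefinite with trace 1. -/
def IsDensityMatrix (ρ : Matrix (Fin 2 × Fin 2) (Fin 2 × Fin 2) ℂ) : Prop :=
  ρ.PosSemidef ∧ ρ.trace = 1

/-- The matrix `F_{α,β}`. -/
def Fmat (α β : ℝ) : Matrix (Fin 4) (Fin 4) ℝ :=
  (1 / (Real.sin α ^ 2 * Real.sin β ^ 2)) •
    !![1, -Real.cos α, -Real.cos β, Real.cos (α + β);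
       -Real.cos α, 1, Real.cos (α - β), -Real.cos β;
       -Real.cos β, Real.cos (α - β), 1, -Real.cos α;
       Real.cos (α + β), -Real.cos β, -Real.cos α, 1]

/-- The quadratic form `γᵀ F_{α,β} γ`. -/
def quadForm (α β : ℝ) (γ : Fin 4 → ℝ) : ℝ := γ ⬝ᵥ (Fmat α β *ᵥ γ)

/-- The matrix `ρ = (1/4)(I₄ + w₁₁ σ₁⊗σ₁ + w₁₂ σ₁⊗σ₂ + w₂₁ σ₂⊗σ₁ + w₂₂ σ₂⊗σ₂ + w₃₃ σ₃⊗σ₃)`. -/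
def rhoW (w11 w12 w21 w22 w33 : ℝ) : Matrix (Fin 2 × Fin 2) (Fin 2 × Fin 2) ℂ :=
  (1 / 4 : ℂ) • ((1 : Matrix (Fin 2 × Fin 2) (Fin 2 × Fin 2) ℂ) +
    (w11 : ℂ) • (σ1 ⊗ₖ σ1) + (w12 : ℂ) • (σ1 ⊗ₖ σ2) +
    (w21 : ℂ) • (σ2 ⊗ₖ σ1) + (w22 : ℂ) • (σ2 ⊗ₖ σ2) + (w33 : ℂ) • (σ3 ⊗ₖ σ3))

lemma aux_form (w11 w12 w21 w22 w33 : ℝ) (x : Fin 2 × Fin 2 → ℂ) :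
    star x ⬝ᵥ (rhoW w11 w12 w21 w22 w33 *ᵥ x) = (((1/4 : ℝ) *
      (((1 + w33) * ((x (0,0)).re^2 + (x (0,0)).im^2 + (x (1,1)).re^2 + (x (1,1)).im^2)
        + 2 * ((w11 - w22) * ((x (0,0)).re * (x (1,1)).re + (x (0,0)).im * (x (1,1)).im)
          + (w12 + w21) * ((x (0,0)).re * (x (1,1)).im - (x (0,0)).im * (x (1,1)).re)))
      + ((1 - w33) * ((x (0,1)).re^2 + (x (0,1)).im^2 + (x (1,0)).re^2 + (x (1,0)).im^2)
        + 2 * ((w11 + w22) * ((x (0,1)).re * (x (1,0)).re + (x (0,1)).im * (x (1,0)).im)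
          + (w21 - w12) * ((x (0,1)).re * (x (1,0)).im - (x (0,1)).im * (x (1,0)).re)))) : ℝ) : ℂ) := by
  apply Complex.ext <;>
  simp [rhoW, σ1, σ2, σ3, dotProduct, mulVec, Fintype.sum_prod_type, Fin.sum_univ_two,
    Matrix.one_apply, -Complex.ofReal_add, -Complex.ofReal_mul, -Complex.ofReal_sub] <;> ring

lemma aux_herm (w11 w12 w21 w22 w33 : ℝ) : (rhoW w11 w12 w21 w22 w33).IsHermitian := by
  ext ⟨i, j⟩ ⟨k, l⟩
  fin_cases i <;> fin_cases j <;> fin_cases k <;> fin_cases l <;>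
    simp [rhoW, σ1, σ2, σ3, Matrix.one_apply] <;> ring

lemma aux_nonneg (s X Y p q r v : ℝ) (h : √(X^2 + Y^2) ≤ s) :
    0 ≤ s * (p^2 + q^2 + r^2 + v^2) + 2 * (X * (p*r + q*v) + Y * (p*v - q*r)) := by
  have hs : 0 ≤ s := (Real.sqrt_nonneg _).trans h
  have h2 : X^2 + Y^2 ≤ s^2 := (Real.sqrt_le_left hs).1 h
  rcases hs.eq_or_lt with h0 | h0
  · subst h0
    have hX : X = 0 := by nlinarith [sq_nonneg X, sq_nonneg Y]
    have hY : Y = 0 := by nlinarith [sq_nonneg X, sq_nonneg Y]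
    simp [hX, hY]
  · refine nonneg_of_mul_nonneg_right (a := s) ?_ h0
    have e : s * (s * (p^2 + q^2 + r^2 + v^2) + 2 * (X * (p*r + q*v) + Y * (p*v - q*r)))
      = (s*p + X*r + Y*v)^2 + (s*q + X*v - Y*r)^2 + (s^2 - (X^2+Y^2)) * (r^2+v^2) := by ring
    rw [e]
    have := mul_nonneg (sub_nonneg.2 h2) (add_nonneg (sq_nonneg r) (sq_nonneg v))
    positivity

lemma aux_le (s X Y : ℝ) (h : ∀ p q r v : ℝ,
    0 ≤ s * (p^2 + q^2 + r^2 + v^2) + 2 * (X * (p*r + q*v) + Y * (p*v - q*r))) :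
    √(X^2 + Y^2) ≤ s := by
  have hs := h 1 0 0 0
  have h1 := h X (-Y) (-√(X^2+Y^2)) 0
  have hR := Real.sq_sqrt (add_nonneg (sq_nonneg X) (sq_nonneg Y))
  have hp := Real.sqrt_nonneg (X^2 + Y^2)
  set R := √(X^2+Y^2)
  rcases hp.eq_or_lt with h0 | h0
  · rw [← h0]; linarith
  · have e : s * (X^2 + (-Y)^2 + (-R)^2 + 0^2) + 2 * (X * (X*(-R) + (-Y)*0) + Y * (X*0 - (-Y)*(-R)))
      = 2 * R^2 * (s - R) := by linear_combination (2 * R - s) * hR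
    rw [e] at h1
    have := nonneg_of_mul_nonneg_right h1 (by positivity)
    linarith

/-- `ρ` is positive semidefinite iff
`1 + w₃₃ ≥ √((w₁₁−w₂₂)² + (w₁₂+w₂₁)²)` and `1 − w₃₃ ≥ √((w₁₁+w₂₂)² + (w₁₂−w₂₁)²)`. -/
theorem stmt10 (w11 w12 w21 w22 w33 : ℝ) :
    (rhoW w11 w12 w21 w22 w33).PosSemidef ↔
      (Real.sqrt ((w11 - w22) ^ 2 + (w12 + w21) ^ 2) ≤ 1 + w33 ∧
        Real.sqrt ((w11 + w22) ^ 2 + (w12 - w21) ^ 2) ≤ 1 - w33) := by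
  rw [posSemidef_iff_dotProduct_mulVec, show (w12 - w21)^2 = (w21 - w12)^2 by ring]
  constructor
  · rintro ⟨-, h⟩
    constructor
    · apply aux_le
      intro p q r v
      have := h (fun i => !![(⟨p, q⟩ : ℂ), 0; 0, ⟨r, v⟩] i.1 i.2)
      rw [aux_form, Complex.zero_le_real] at this
      simp at this
      linarith
    · apply aux_le
      intro p q r v
      have := h (fun i => !![0, (⟨p, q⟩ : ℂ); ⟨r, v⟩, 0] i.1 i.2)
      rw [aux_form, Complex.zero_le_real] at this
      simp at this
      linarith
  · rintro ⟨h1, h2⟩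
    refine ⟨aux_herm _ _ _ _ _, fun x => ?_⟩
    rw [aux_form, Complex.zero_le_real]
    exact mul_nonneg (by norm_num) (add_nonneg (aux_nonneg _ _ _ _ _ _ _ h1) (aux_nonneg _ _ _ _ _ _ _ h2))
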